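/- Let f : K → K be a homeomorphism of a compact metric space K, let A : K → SL(2,ℝ) be continuous, and let ε>0. Suppose there exist points x_k ∈ K and integers n_k → ∞ such that ‖A_{n_k}(x_k)‖ ≥ e^{ε n_k} for every k. Then there exists an f-invariant Borel probability measure μ on K with L(f,A,μ) ≥ ε. -/

import Mathlib

open MeasureTheory Filter Topology

instance : TopologicalSpace (Matrix.SpecialLinearGroup (Fin 2) ℝ) :=
  TopologicalSpace.induced (fun M => (M : Matrix (Fin 2) (Fin 2) ℝ)) inferInstance

/-- Operator norm (w.r.t. the euclidean norm on ℝ²) of a 2×2 real matrix. -/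
noncomputable def matOpNorm (M : Matrix (Fin 2) (Fin 2) ℝ) : ℝ :=
  ‖Matrix.toEuclideanCLM (𝕜 := ℝ) M‖

noncomputable def sl2Norm (M : Matrix.SpecialLinearGroup (Fin 2) ℝ) : ℝ :=
  matOpNorm (M : Matrix (Fin 2) (Fin 2) ℝ)

/-- The cocycle iterates: `cocycle f A n x = A(f^{n-1} x) ⋯ A(f x) A(x)`. -/
noncomputable def cocycle {K : Type*} (f : K → K)
    (A : K → Matrix.SpecialLinearGroup (Fin 2) ℝ) :
    ℕ → K → Matrix.SpecialLinearGroup (Fin 2) ℝ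
  | 0, _ => 1
  | (n+1), x => cocycle f A n (f x) * A x

/-- The cocycle `(f,A)` is uniformly hyperbolic. -/
def UnifHyp {K : Type*} (f : K → K) (A : K → Matrix.SpecialLinearGroup (Fin 2) ℝ) : Prop :=
  ∃ ε > (0:ℝ), ∃ N : ℕ, ∀ x : K, ∀ n ≥ N, Real.exp (ε * n) ≤ sl2Norm (cocycle f A n x)

/-- The cocycle `(f,A)` has uniform subexponential growth. -/
def UnifSubexp {K : Type*} (f : K → K) (A : K → Matrix.SpecialLinearGroup (Fin 2) ℝ) : Prop :=
  ∀ ε > (0:ℝ), ∃ N : ℕ, ∀ x : K, ∀ n ≥ N, sl2Norm (cocycle f A n x) ≤ Real.exp (ε * n)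

open Finset in
/-- The empirical measure of a nonempty orbit segment: integrating against it is the same as taking
a Birkhoff average. -/
theorem exists_probabilityMeasure_integral_eq_birkhoffAverage {K : Type*} [MetricSpace K]
    [MeasurableSpace K] [BorelSpace K] (f : K → K) (x : K) {N : ℕ} (hN : N ≠ 0) :
    ∃ ν : ProbabilityMeasure K, ∀ g : K → ℝ,
      ∫ y, g y ∂(ν : Measure K) = birkhoffAverage ℝ f g N x := by
  have hprob : IsProbabilityMeasure
      ((N : ENNReal)⁻¹ • ∑ i ∈ range N, Measure.dirac (f^[i] x)) := by
    constructor
    simp [ENNReal.inv_mul_cancel (Nat.cast_ne_zero.2 hN) (ENNReal.natCast_ne_top N)]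
  refine ⟨⟨_, hprob⟩, fun g => ?_⟩
  have hint : ∀ i ∈ range N, Integrable g (Measure.dirac (f^[i] x)) := fun i _ =>
    integrable_dirac (by simp [enorm_lt_top])
  simp [birkhoffAverage, birkhoffSum, integral_smul_measure, integral_finsetSum_measure hint]

/-- The Krylov–Bogolyubov construction along orbit segments of increasing lengths. -/
theorem exists_invariant_tendsto_birkhoffAverage {K : Type*} [MetricSpace K] [CompactSpace K]
    [MeasurableSpace K] [BorelSpace K] {f : K → K} (hf : Continuous f)
    (x : ℕ → K) {n : ℕ → ℕ} (hn : Tendsto n atTop atTop) :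
    ∃ μ : Measure K, IsProbabilityMeasure μ ∧ μ.map f = μ ∧
      ∃ U : Ultrafilter ℕ, ↑U ≤ (atTop : Filter ℕ) ∧ ∀ g : K → ℝ, Continuous g →
        Tendsto (fun k => birkhoffAverage ℝ f g (n k) (x k)) U (𝓝 (∫ y, g y ∂μ)) := by
  have hex : ∀ k, ∃ ν : ProbabilityMeasure K, n k ≠ 0 → ∀ g : K → ℝ,
      ∫ y, g y ∂(ν : Measure K) = birkhoffAverage ℝ f g (n k) (x k) := by
    intro k
    by_cases h : n k = 0
    · exact ⟨⟨Measure.dirac (x k), inferInstance⟩, fun h' => absurd h h'⟩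
    · obtain ⟨ν, hν⟩ := exists_probabilityMeasure_integral_eq_birkhoffAverage f (x k) h
      exact ⟨ν, fun _ => hν⟩
  choose ν hν using hex
  let U : Ultrafilter ℕ := hyperfilter ℕ
  have hU : ↑U ≤ (atTop : Filter ℕ) := Nat.hyperfilter_le_atTop
  obtain ⟨μ, hμ⟩ : ∃ μ, Tendsto ν U (𝓝 μ) :=
    ⟨(U.map ν).lim, (U.map ν).le_nhds_lim⟩
  have hlim : ∀ g : K → ℝ, Continuous g →
      Tendsto (fun k => birkhoffAverage ℝ f g (n k) (x k)) U (𝓝 (∫ y, g y ∂(μ : Measure K))) := by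
    intro g hg
    have h := ProbabilityMeasure.tendsto_iff_forall_integral_tendsto.1 hμ
      (BoundedContinuousFunction.mkOfCompact ⟨g, hg⟩)
    refine h.congr' ?_
    filter_upwards [hU (hn.eventually_ne_atTop 0)] with k hk
    exact hν k hk g
  refine ⟨μ, inferInstance, ?_, U, hU, hlim⟩
  have : IsProbabilityMeasure ((μ : Measure K).map f) :=
    Measure.isProbabilityMeasure_map hf.aemeasurable
  refine ext_of_forall_integral_eq_of_IsFiniteMeasure fun g => ?_
  rw [integral_map hf.aemeasurable g.continuous.aestronglyMeasurable]
  have hdiff := (hlim _ (g.continuous.comp hf)).sub (hlim _ g.continuous)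
  refine sub_eq_zero.1 (tendsto_nhds_unique hdiff ?_)
  have hzero : Tendsto (fun k => ((n k : ℝ))⁻¹ * (2 * ‖g‖)) atTop (𝓝 0) := by
    simpa using (tendsto_inv_atTop_nhds_zero_nat (𝕜 := ℝ)).comp hn |>.mul_const (2 * ‖g‖)
  refine squeeze_zero_norm (fun k => ?_) (hzero.mono_left hU)
  have hcomp : birkhoffAverage ℝ f (g ∘ f) (n k) (x k) =
      birkhoffAverage ℝ f g (n k) (f (x k)) := by
    simp [birkhoffAverage, birkhoffSum, ← Function.iterate_succ_apply, Function.iterate_succ_apply']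
  have hg : ‖g (f^[n k] (x k)) - g (x k)‖ ≤ 2 * ‖g‖ := by
    rw [← dist_eq_norm]; exact g.dist_le_two_norm _ _
  rw [hcomp, birkhoffAverage_apply_sub_birkhoffAverage, norm_smul, norm_inv, RCLike.norm_natCast]
  gcongr

/-- A subadditive cocycle of nonnegative functions is controlled by the Birkhoff sums of any of its
members, up to a bounded error. -/
theorem mul_le_birkhoffSum_add_of_subadditive {K : Type*} {f : K → K} {φ : ℕ → K → ℝ}
    (h_nonneg : ∀ m y, 0 ≤ φ m y) (h_zero : ∀ y, φ 0 y = 0)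
    (h_sub : ∀ p m y, φ (p + m) y ≤ φ m (f^[p] y) + φ p y)
    {C : ℝ} (hC : ∀ y, φ 1 y ≤ C) (m N : ℕ) (hmN : m ≤ N) (y : K) :
    m * φ N y ≤ birkhoffSum f (φ m) N y + 2 * (m * (m * C)) := by
  have h_lin : ∀ m y, φ m y ≤ m * C := by
    intro m y
    induction m with
    | zero => simp [h_zero]
    | succ m ih =>
      push_cast
      linarith [h_sub m 1 y, hC (f^[m] y)]
  have hC0 : 0 ≤ C := (h_nonneg 1 y).trans (hC y)
  have h_tel : ∀ M, ∑ j ∈ Finset.range m, φ (M + j) y ≤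
      birkhoffSum f (φ m) M y + ∑ j ∈ Finset.range m, φ j y := by
    intro M
    induction M with
    | zero => simp
    | succ M ih =>
      have h1 := Finset.sum_range_succ' (fun j => φ (M + j) y) m
      have h2 := Finset.sum_range_succ (fun j => φ (M + j) y) m
      have h3 : ∑ j ∈ Finset.range m, φ (M + 1 + j) y =
          ∑ j ∈ Finset.range m, φ (M + (j + 1)) y :=
        Finset.sum_congr rfl fun j _ => by rw [add_assoc, add_comm 1 j]
      rw [birkhoffSum_succ, h3]
      simp only [add_zero] at h1
      linarith [h_sub M m y]
  obtain ⟨M, rfl⟩ := Nat.exists_eq_add_of_le' hmN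
  have h_low : (m : ℝ) * φ (M + m) y ≤
      ∑ j ∈ Finset.range m, φ (M + j) y + m * (m * C) := by
    have : ∑ _j ∈ Finset.range m, (φ (M + m) y - m * C) ≤ ∑ j ∈ Finset.range m, φ (M + j) y := by
      refine Finset.sum_le_sum fun j hj => ?_
      have hj' := (Finset.mem_range.1 hj).le
      have h1 := h_sub (M + j) (m - j) y
      rw [add_assoc, Nat.add_sub_cancel' hj'] at h1
      have h2 : ((m - j : ℕ) : ℝ) * C ≤ m * C := by
        gcongr
        exact Nat.sub_le m j
      linarith [h_lin (m - j) (f^[M + j] y)]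
    simp only [Finset.sum_const, Finset.card_range, nsmul_eq_mul] at this
    linarith
  have h_first : ∑ j ∈ Finset.range m, φ j y ≤ m * (m * C) := by
    have : ∑ j ∈ Finset.range m, φ j y ≤ ∑ _j ∈ Finset.range m, (m : ℝ) * C := by
      refine Finset.sum_le_sum fun j hj => (h_lin j y).trans ?_
      gcongr
      exact (Finset.mem_range.1 hj).le
    simpa using this
  have h_mono : birkhoffSum f (φ m) M y ≤ birkhoffSum f (φ m) (M + m) y :=
    Finset.sum_le_sum_of_subset_of_nonneg (Finset.range_mono (Nat.le_add_right M m))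
      fun i _ _ => h_nonneg m _
  linarith [h_tel M]

theorem one_le_sl2Norm (M : Matrix.SpecialLinearGroup (Fin 2) ℝ) : 1 ≤ sl2Norm M := by
  have hcol : ∀ j, (M.1 0 j) ^ 2 + (M.1 1 j) ^ 2 ≤ sl2Norm M ^ 2 := by
    intro j
    have h := (Matrix.toEuclideanCLM (𝕜 := ℝ) M.1).le_opNorm (EuclideanSpace.single j 1)
    rw [PiLp.norm_single, norm_one, mul_one] at h
    have h2 := pow_le_pow_left₀ (norm_nonneg _) h 2
    rw [EuclideanSpace.norm_sq_eq] at h2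
    simpa [sl2Norm, matOpNorm, Fin.sum_univ_two, Matrix.ofLp_toEuclideanCLM] using h2
  have hdet := M.2
  rw [Matrix.det_fin_two] at hdet
  have h0 : 0 ≤ sl2Norm M := norm_nonneg _
  nlinarith [hcol 0, hcol 1, sq_nonneg (M.1 0 0 - M.1 1 1), sq_nonneg (M.1 0 1 + M.1 1 0)]

theorem sl2Norm_mul_le (M N : Matrix.SpecialLinearGroup (Fin 2) ℝ) :
    sl2Norm (M * N) ≤ sl2Norm M * sl2Norm N := by
  simp only [sl2Norm, matOpNorm, Matrix.SpecialLinearGroup.coe_mul, map_mul]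
  exact norm_mul_le _ _

theorem continuous_sl2_coe :
    Continuous fun M : Matrix.SpecialLinearGroup (Fin 2) ℝ => (M : Matrix (Fin 2) (Fin 2) ℝ) :=
  continuous_induced_dom

theorem continuous_matOpNorm : Continuous matOpNorm :=
  (LinearMap.continuous_of_finiteDimensional
    (Matrix.toEuclideanCLM (n := Fin 2) (𝕜 := ℝ)).toAlgEquiv.toLinearMap).norm

theorem cocycle_add {K : Type*} (f : K → K) (A : K → Matrix.SpecialLinearGroup (Fin 2) ℝ)
    (p m : ℕ) (y : K) : cocycle f A (p + m) y = cocycle f A m (f^[p] y) * cocycle f A p y := by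
  induction p generalizing y with
  | zero => simp [cocycle]
  | succ p ih =>
    rw [Nat.add_right_comm, cocycle, ih, cocycle, mul_assoc, Function.iterate_succ_apply]

theorem continuous_coe_cocycle {K : Type*} [TopologicalSpace K] {f : K → K} (hf : Continuous f)
    {A : K → Matrix.SpecialLinearGroup (Fin 2) ℝ} (hA : Continuous A) (m : ℕ) :
    Continuous fun y => (cocycle f A m y : Matrix (Fin 2) (Fin 2) ℝ) := by
  induction m with
  | zero => exact continuous_const
  | succ m ih =>
    simp only [cocycle, Matrix.SpecialLinearGroup.coe_mul]
    exact (ih.comp hf).mul (continuous_sl2_coe.comp hA)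

theorem continuous_log_sl2Norm_cocycle {K : Type*} [TopologicalSpace K] {f : K → K}
    (hf : Continuous f) {A : K → Matrix.SpecialLinearGroup (Fin 2) ℝ} (hA : Continuous A) (m : ℕ) :
    Continuous fun y => Real.log (sl2Norm (cocycle f A m y)) :=
  (continuous_matOpNorm.comp (continuous_coe_cocycle hf hA m)).log
    fun _ => (zero_lt_one.trans_le (one_le_sl2Norm _)).ne'

theorem log_sl2Norm_cocycle_add_le {K : Type*} (f : K → K)
    (A : K → Matrix.SpecialLinearGroup (Fin 2) ℝ) (p m : ℕ) (y : K) :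
    Real.log (sl2Norm (cocycle f A (p + m) y)) ≤
      Real.log (sl2Norm (cocycle f A m (f^[p] y))) + Real.log (sl2Norm (cocycle f A p y)) := by
  have hpos : ∀ M, 0 < sl2Norm M := fun M => zero_lt_one.trans_le (one_le_sl2Norm M)
  rw [← Real.log_mul (hpos _).ne' (hpos _).ne', cocycle_add]
  exact Real.log_le_log (hpos _) (sl2Norm_mul_le _ _)

/-- For an invariant measure, the integrals of a subadditive cocycle form a subadditive sequence. -/
theorem subadditive_integral {K : Type*} [MeasurableSpace K] {μ : Measure K} {f : K → K}
    (hf : MeasurePreserving f μ μ) {φ : ℕ → K → ℝ} (h_int : ∀ m, Integrable (φ m) μ)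
    (h_sub : ∀ p m y, φ (p + m) y ≤ φ m (f^[p] y) + φ p y) :
    Subadditive fun m => ∫ y, φ m y ∂μ := by
  intro p m
  have hp := hf.iterate p
  have hcomp : Integrable (fun y => φ m (f^[p] y)) μ := hp.integrable_comp_of_integrable (h_int m)
  have hinv : ∫ y, φ m (f^[p] y) ∂μ = ∫ y, φ m y ∂μ := by
    have hm : AEStronglyMeasurable (φ m) (μ.map f^[p]) := by
      rw [hp.map_eq]; exact (h_int m).aestronglyMeasurable
    rw [← integral_map hp.measurable.aemeasurable hm, hp.map_eq]
  calc ∫ y, φ (p + m) y ∂μ ≤ ∫ y, (φ m (f^[p] y) + φ p y) ∂μ :=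
        integral_mono (h_int _) (hcomp.add (h_int p)) (h_sub p m)
    _ = ∫ y, φ p y ∂μ + ∫ y, φ m y ∂μ := by
        rw [integral_add hcomp (h_int p), hinv, add_comm]

/-- Exponential growth along a sequence of orbit segments produces an invariant
measure with Lyapunov exponent at least `ε`. -/
theorem stmt_2 {K : Type*} [MetricSpace K] [CompactSpace K]
    [MeasurableSpace K] [BorelSpace K]
    (f : K ≃ₜ K) (A : C(K, Matrix.SpecialLinearGroup (Fin 2) ℝ))
    (ε : ℝ) (hε : 0 < ε)
    (x : ℕ → K) (n : ℕ → ℕ) (hn : Tendsto n atTop atTop)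
    (hgrow : ∀ k : ℕ, Real.exp (ε * n k) ≤ sl2Norm (cocycle (⇑f) (⇑A) (n k) (x k))) :
    ∃ μ : Measure K, IsProbabilityMeasure μ ∧ Measure.map (⇑f) μ = μ ∧
      ∃ L : ℝ, ε ≤ L ∧
        Tendsto (fun m : ℕ =>
            (m : ℝ)⁻¹ * ∫ y, Real.log (sl2Norm (cocycle (⇑f) (⇑A) m y)) ∂μ)
          atTop (nhds L) := by
  obtain ⟨μ, hμ, hinv, U, hU, hlim⟩ := exists_invariant_tendsto_birkhoffAverage f.continuous x hn
  refine ⟨μ, hμ, hinv, ?_⟩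
  set φ : ℕ → K → ℝ := fun m y => Real.log (sl2Norm (cocycle f A m y)) with hφ
  have h_cont : ∀ m, Continuous (φ m) := continuous_log_sl2Norm_cocycle f.continuous A.continuous
  have h_nonneg : ∀ m y, 0 ≤ φ m y := fun m y => Real.log_nonneg (one_le_sl2Norm _)
  have h_sub : ∀ p m y, φ (p + m) y ≤ φ m (f^[p] y) + φ p y := log_sl2Norm_cocycle_add_le f A
  have h_zero : ∀ y, φ 0 y = 0 := fun y => by
    simp [hφ, cocycle, sl2Norm, matOpNorm]
  have h_int : ∀ m, Integrable (φ m) μ := fun m =>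
    (h_cont m).integrable_of_hasCompactSupport (HasCompactSupport.of_compactSpace _)
  obtain ⟨C, hC⟩ : ∃ C, ∀ y, φ 1 y ≤ C :=
    (isCompact_range (h_cont 1)).bddAbove.imp fun C hC y => hC ⟨y, rfl⟩
  have h_subadd : Subadditive fun m => ∫ y, φ m y ∂μ :=
    subadditive_integral ⟨f.continuous.measurable, hinv⟩ h_int h_sub
  have h_bdd : BddBelow (Set.range fun m : ℕ => (∫ y, φ m y ∂μ) / m) :=
    ⟨0, by rintro _ ⟨m, rfl⟩; exact div_nonneg (integral_nonneg (h_nonneg m)) m.cast_nonneg⟩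
  have h_tendsto := h_subadd.tendsto_lim h_bdd
  have h_lower : ∀ m : ℕ, m * ε ≤ ∫ y, φ m y ∂μ := by
    intro m
    have h_err : Tendsto (fun k => (n k : ℝ)⁻¹ * (2 * (m * (m * C)))) atTop (𝓝 0) := by
      simpa using
        (tendsto_inv_atTop_nhds_zero_nat (𝕜 := ℝ)).comp hn |>.mul_const (2 * (m * (m * C)))
    have h_sum := (hlim (φ m) (h_cont m)).add (h_err.mono_left hU)
    rw [add_zero] at h_sum
    refine ge_of_tendsto h_sum (hU ?_)
    filter_upwards [hn.eventually_ge_atTop m, hn.eventually_gt_atTop 0] with k hmk hk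
    have hk' : (0 : ℝ) < n k := Nat.cast_pos.2 hk
    have h1 := mul_le_birkhoffSum_add_of_subadditive h_nonneg h_zero h_sub hC m (n k) hmk (x k)
    have h2 : ε * n k ≤ φ (n k) (x k) :=
      (Real.le_log_iff_exp_le (zero_lt_one.trans_le (one_le_sl2Norm _))).2 (hgrow k)
    rw [birkhoffAverage, smul_eq_mul, ← mul_add, ← div_eq_inv_mul, le_div_iff₀ hk', mul_assoc]
    exact (mul_le_mul_of_nonneg_left h2 m.cast_nonneg).trans h1
  refine ⟨h_subadd.lim, ge_of_tendsto h_tendsto ?_, by simpa only [div_eq_inv_mul] using h_tendsto⟩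
  filter_upwards [eventually_gt_atTop 0] with m hm
  rw [le_div_iff₀ (Nat.cast_pos.2 hm), mul_comm]
  exact h_lower m
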